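/- arXiv:2101.07706 — 5 statements merged into one kernel-verified Lean document; each statement's English description precedes it below -/
import Mathlib

section
/- Under linear weighted sampling with inclusion probabilities p_j = B·q_j, the total estimation variance is at most V_lnr: ∑_{j∈N} (1/(B·q_j) − 1)·‖w_{*j}‖²·‖x_j‖² ≤ (|N|/B − 1)·(∑_{k∈N} ‖w_{*k}‖²)·C, provided ‖x_j‖² ≤ C for all j ∈ N. -/
/-- Under linear weighted sampling with inclusion probabilities `p_j = B·q_j`, the total
estimation variance is at most `V_lnr`:
`∑_{j∈N} (1/(B·q_j) − 1)·‖w_{*j}‖²·‖x_j‖² ≤ (|N|/B − 1)·(∑_{k∈N} ‖w_{*k}‖²)·C`,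
provided `‖x_j‖² ≤ C` for all `j ∈ N`. -/
theorem linear_weighted_sampling_variance_bound
    {κ ι : Type*} {d : ℕ} (S : Finset κ) (N : Finset ι)
    (w : κ → ι → ℝ) (x : ι → EuclideanSpace ℝ (Fin d)) (C : ℝ)
    (W : ι → ℝ) (hW : ∀ j, W j = ∑ i ∈ S, (w i j) ^ 2)
    (hWpos : ∀ j ∈ N, 0 < W j)
    (hC : 0 ≤ C) (hx : ∀ j ∈ N, ‖x j‖ ^ 2 ≤ C)
    (q : ι → ℝ) (hq : ∀ j ∈ N, q j = W j / ∑ k ∈ N, W k)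
    (B : ℝ) (hB : 0 < B) (hBq : ∀ j ∈ N, B * q j ≤ 1) :
    ∑ j ∈ N, (1 / (B * q j) - 1) * W j * ‖x j‖ ^ 2
      ≤ ((N.card : ℝ) / B - 1) * (∑ k ∈ N, W k) * C := by
  have hterm : ∀ j ∈ N, (1 / (B * q j) - 1) * W j * ‖x j‖ ^ 2
      ≤ ((∑ k ∈ N, W k) / B - W j) * C := by
    intro j hj
    have hWj := hWpos j hj
    have hT : 0 < ∑ k ∈ N, W k := Finset.sum_pos hWpos ⟨j, hj⟩
    have hqj : 0 < q j := by
      rw [hq j hj]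
      positivity
    have hp : 1 ≤ 1 / (B * q j) := one_le_one_div (mul_pos hB hqj) (hBq j hj)
    have hcoeff : (1 / (B * q j) - 1) * W j = (∑ k ∈ N, W k) / B - W j := by
      rw [hq j hj]
      field_simp
    rw [← hcoeff]
    exact mul_le_mul_of_nonneg_left (hx j hj) (mul_nonneg (sub_nonneg.2 hp) hWj.le)
  refine (Finset.sum_le_sum hterm).trans_eq ?_
  rw [← Finset.sum_mul, Finset.sum_sub_distrib, Finset.sum_const, nsmul_eq_mul]
  ring
end

section
/- Under skewed linear weighted sampling with scale factor s and inclusion probabilities p_j = B·q_j(s), the total estimation variance is at most V_skewed(s): ∑_{j∈N} (1/(B·q_j(s)) − 1)·‖w_{*j}‖²·‖x_j‖² ≤ ((|L|/(s·B) + |R|/B)·(s·A_L + A_R) − (A_L + A_R))·C, provided ‖x_j‖² ≤ C for all j ∈ N. -/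
/-- The variance contribution of an item of weight `W`, kept with probability
`B * q` where `q = c * W / D`, is at most `(D / (c * B) - W) * C` if its squared norm is
at most `C`. -/
theorem inverse_probability_term_le {c W D B q y C : ℝ} (hc : 0 < c) (hW : 0 < W)
    (hD : 0 < D) (hB : 0 < B) (hq : q = c * W / D) (hBq : B * q ≤ 1) (hy : y ≤ C) :
    (1 / (B * q) - 1) * W * y ≤ (D / (c * B) - W) * C := by
  have hq0 : 0 < B * q := by rw [hq]; positivity
  have hcoef : (1 / (B * q) - 1) * W = D / (c * B) - W := by
    rw [hq]
    field_simp
  rw [← hcoef]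
  exact mul_le_mul_of_nonneg_left hy
    (mul_nonneg (sub_nonneg.2 ((one_le_div hq0).2 hBq)) hW.le)

/-- Under skewed linear weighted sampling with scale factor `s` and inclusion
probabilities `p_j = B·q_j(s)`, the total estimation variance is at most `V_skewed(s)`:
`∑_{j∈N} (1/(B·q_j(s)) − 1)·‖w_{*j}‖²·‖x_j‖²
  ≤ ((|L|/(s·B) + |R|/B)·(s·A_L + A_R) − (A_L + A_R))·C`,
provided `‖x_j‖² ≤ C` for all `j ∈ N`. -/
theorem skewed_linear_weighted_sampling_variance_bound
    {κ ι : Type*} [DecidableEq ι] {d : ℕ} (S : Finset κ) (N L R : Finset ι)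
    (hpart : N = L ∪ R) (hdisj : Disjoint L R)
    (w : κ → ι → ℝ) (x : ι → EuclideanSpace ℝ (Fin d)) (C : ℝ)
    (W : ι → ℝ) (hW : ∀ j, W j = ∑ i ∈ S, (w i j) ^ 2)
    (hWpos : ∀ j ∈ N, 0 < W j)
    (hC : 0 ≤ C) (hx : ∀ j ∈ N, ‖x j‖ ^ 2 ≤ C)
    (AL AR : ℝ) (hAL : AL = ∑ k ∈ L, W k) (hAR : AR = ∑ k ∈ R, W k)
    (s : ℝ) (hs : 1 < s)
    (q : ι → ℝ)
    (hqL : ∀ j ∈ L, q j = s * W j / (s * AL + AR))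
    (hqR : ∀ j ∈ R, q j = W j / (s * AL + AR))
    (B : ℝ) (hB : 0 < B) (hBq : ∀ j ∈ N, B * q j ≤ 1) :
    ∑ j ∈ N, (1 / (B * q j) - 1) * W j * ‖x j‖ ^ 2
      ≤ (((L.card : ℝ) / (s * B) + (R.card : ℝ) / B) * (s * AL + AR) - (AL + AR)) * C := by
  subst hpart
  have hWL : ∀ j ∈ L, 0 < W j := fun j hj => hWpos j (Finset.mem_union_left R hj)
  have hWR : ∀ j ∈ R, 0 < W j := fun j hj => hWpos j (Finset.mem_union_right L hj)
  have hs0 : 0 < s := one_pos.trans hs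
  have hAL0 : 0 ≤ AL := hAL ▸ Finset.sum_nonneg fun j hj => (hWL j hj).le
  have hAR0 : 0 ≤ AR := hAR ▸ Finset.sum_nonneg fun j hj => (hWR j hj).le
  have hDL : ∀ j ∈ L, 0 < s * AL + AR := fun j hj => by
    have : 0 < AL := hAL ▸ Finset.sum_pos hWL ⟨j, hj⟩
    positivity
  have hDR : ∀ j ∈ R, 0 < s * AL + AR := fun j hj => by
    have : 0 < AR := hAR ▸ Finset.sum_pos hWR ⟨j, hj⟩
    positivity
  have hL : ∑ j ∈ L, (1 / (B * q j) - 1) * W j * ‖x j‖ ^ 2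
      ≤ ∑ j ∈ L, ((s * AL + AR) / (s * B) - W j) * C := by
    refine Finset.sum_le_sum fun j hj => ?_
    have hj' := Finset.mem_union_left R hj
    exact inverse_probability_term_le hs0 (hWL j hj) (hDL j hj) hB (hqL j hj)
      (hBq j hj') (hx j hj')
  have hR : ∑ j ∈ R, (1 / (B * q j) - 1) * W j * ‖x j‖ ^ 2
      ≤ ∑ j ∈ R, ((s * AL + AR) / (1 * B) - W j) * C := by
    refine Finset.sum_le_sum fun j hj => ?_
    have hj' := Finset.mem_union_right L hj
    exact inverse_probability_term_le one_pos (hWR j hj) (hDR j hj) hB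
      (by rw [hqR j hj, one_mul]) (hBq j hj') (hx j hj')
  rw [Finset.sum_union hdisj]
  refine (add_le_add hL hR).trans_eq ?_
  rw [← Finset.sum_mul, ← Finset.sum_mul, Finset.sum_sub_distrib, Finset.sum_sub_distrib,
    ← hAL, ← hAR]
  simp only [Finset.sum_const, nsmul_eq_mul, one_mul]
  ring
end

section
/- Skewed sampling can strictly decrease the variance bound: for any scale factor s > 1 and C > 0, V_skewed(s) < V_lnr if and only if s·|R|·A_L < |L|·A_R. -/
/-- Skewed sampling can strictly decrease the variance bound: for any scale factor
`s > 1` and `C > 0`, `V_skewed(s) < V_lnr` if and only if `s·|R|·A_L < |L|·A_R`. -/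
theorem skewed_variance_strictly_smaller_iff
    (L R : ℕ) (AL AR B C s : ℝ)
    (hAL : 0 ≤ AL) (hAR : 0 ≤ AR) (hB : 0 < B) (hC : 0 < C) (hs : 1 < s) :
    (((L : ℝ) / (s * B) + (R : ℝ) / B) * (s * AL + AR) - (AL + AR)) * C
        < (((L : ℝ) + (R : ℝ)) / B - 1) * (AL + AR) * C
      ↔ s * (R : ℝ) * AL < (L : ℝ) * AR := by
  have hs₀ : 0 < s := by linarith
  have hk : 0 < C * (s - 1) / (s * B) :=
    div_pos (mul_pos hC (sub_pos.2 hs)) (mul_pos hs₀ hB)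
  have key : (((L : ℝ) + (R : ℝ)) / B - 1) * (AL + AR) * C
      - (((L : ℝ) / (s * B) + (R : ℝ) / B) * (s * AL + AR) - (AL + AR)) * C
      = C * (s - 1) / (s * B) * ((L : ℝ) * AR - s * (R : ℝ) * AL) := by
    field_simp
    ring
  rw [← sub_pos, key, mul_pos_iff_of_pos_left hk, sub_pos]
end

section
/- The exact upper bound for the scale factor from Theorem 1's proof: under the stated hypotheses, s_max = (T₁ + T₂)/2 + √((T₁ + T₂)² − 4·T₃)/2 satisfies V_skewed(s_max) = D₁·V_lnr, i.e. s_max is the larger root of the quadratic equation V_skewed(s) = D₁·V_lnr. -/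
/-- The exact upper bound for the scale factor from Theorem 1's proof:
`s_max = (T₁ + T₂)/2 + √((T₁ + T₂)² − 4·T₃)/2` satisfies `V_skewed(s_max) = D₁·V_lnr`. -/
theorem scale_factor_upper_bound_root
    (L R : ℕ) (hL : 1 ≤ L) (hR : 1 ≤ R)
    (AL AR B C D₁ : ℝ)
    (hAL : 0 < AL) (hAR : 0 ≤ AR) (hB : 0 < B) (hBle : B ≤ (L : ℝ) + (R : ℝ))
    (hC : 0 < C) (hD : 1 ≤ D₁)
    (T₁ T₂ T₃ : ℝ)
    (hT₁ : T₁ = (D₁ - 1) * ((L : ℝ) + (R : ℝ) - B) / (R : ℝ) + 1)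
    (hT₂ : T₂ = ((D₁ - 1) * ((L : ℝ) + (R : ℝ) - B) + (L : ℝ)) * AR / ((R : ℝ) * AL))
    (hT₃ : T₃ = (L : ℝ) * AR / ((R : ℝ) * AL))
    (smax : ℝ)
    (hsmax : smax = (T₁ + T₂) / 2 + Real.sqrt ((T₁ + T₂) ^ 2 - 4 * T₃) / 2) :
    (((L : ℝ) / (smax * B) + (R : ℝ) / B) * (smax * AL + AR) - (AL + AR)) * C
      = D₁ * ((((L : ℝ) + (R : ℝ)) / B - 1) * (AL + AR) * C) := by
  have hR0 : (0 : ℝ) < R := by exact_mod_cast hR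
  have hk : 0 ≤ (D₁ - 1) * ((L : ℝ) + (R : ℝ) - B) :=
    mul_nonneg (by linarith) (by linarith)
  have h₁ : 1 ≤ T₁ := by
    rw [hT₁]
    linarith [div_nonneg hk hR0.le]
  have h₃ : 0 ≤ T₃ := by
    rw [hT₃]
    positivity
  have h₂ : T₃ ≤ T₂ := by
    rw [hT₂, hT₃]
    gcongr
    linarith
  have hdisc : 0 ≤ (T₁ + T₂) ^ 2 - 4 * T₃ := by
    nlinarith [sq_nonneg (1 - T₃)]
  have hs : 0 < smax := by
    rw [hsmax]
    linarith [Real.sqrt_nonneg ((T₁ + T₂) ^ 2 - 4 * T₃)]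
  have hquad : smax ^ 2 - (T₁ + T₂) * smax + T₃ = 0 := by
    rw [hsmax]
    linear_combination Real.sq_sqrt hdisc / 4
  rw [hT₁, hT₂, hT₃] at hquad
  field_simp at hquad ⊢
  linear_combination hquad
end

section
/- The skewed variance bound stays within a constant factor of the linear one for every scale factor up to s_max: under the stated hypotheses, for every s with 1 ≤ s ≤ s_max = (T₁ + T₂)/2 + √((T₁ + T₂)² − 4·T₃)/2, it holds that V_skewed(s) ≤ D₁·V_lnr. -/
/-- A monic quadratic that is nonpositive at `1` stays nonpositive up to its larger root. -/
theorem sq_sub_mul_add_nonpos_of_le_larger_root {b c s : ℝ} (h_one : 1 - b + c ≤ 0)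
    (hs : 1 ≤ s) (hsr : s ≤ b / 2 + Real.sqrt (b ^ 2 - 4 * c) / 2) :
    s ^ 2 - b * s + c ≤ 0 := by
  rcases le_total b (2 * s) with h | h
  · have hdisc : 0 ≤ b ^ 2 - 4 * c := by nlinarith [sq_nonneg (b - 2)]
    have hsq : (2 * s - b) ^ 2 ≤ b ^ 2 - 4 * c :=
      (Real.le_sqrt (by linarith) hdisc).1 (by linarith)
    linarith
  · nlinarith [mul_nonneg (sub_nonneg.2 hs) (by linarith : 0 ≤ b - s - 1)]


/-- The skewed variance bound stays within a constant factor of the linear one for every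
scale factor up to `s_max`: for every `s` with `1 ≤ s ≤ s_max`,
`V_skewed(s) ≤ D₁·V_lnr`. -/
theorem skewed_variance_bounded_up_to_smax
    (L R : ℕ) (hL : 1 ≤ L) (hR : 1 ≤ R)
    (AL AR B C D₁ : ℝ)
    (hAL : 0 < AL) (hAR : 0 ≤ AR) (hB : 0 < B) (hBle : B ≤ (L : ℝ) + (R : ℝ))
    (hC : 0 < C) (hD : 1 ≤ D₁)
    (T₁ T₂ T₃ : ℝ)
    (hT₁ : T₁ = (D₁ - 1) * ((L : ℝ) + (R : ℝ) - B) / (R : ℝ) + 1)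
    (hT₂ : T₂ = ((D₁ - 1) * ((L : ℝ) + (R : ℝ) - B) + (L : ℝ)) * AR / ((R : ℝ) * AL))
    (hT₃ : T₃ = (L : ℝ) * AR / ((R : ℝ) * AL))
    (smax : ℝ)
    (hsmax : smax = (T₁ + T₂) / 2 + Real.sqrt ((T₁ + T₂) ^ 2 - 4 * T₃) / 2) :
    ∀ s : ℝ, 1 ≤ s → s ≤ smax →
      (((L : ℝ) / (s * B) + (R : ℝ) / B) * (s * AL + AR) - (AL + AR)) * C
        ≤ D₁ * ((((L : ℝ) + (R : ℝ)) / B - 1) * (AL + AR) * C) := by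
  intro s hs hsm
  have hL0 : (0 : ℝ) < L := by exact_mod_cast hL
  have hR0 : (0 : ℝ) < R := by exact_mod_cast hR
  have hs0 : 0 < s := by linarith
  have hE : 0 ≤ (D₁ - 1) * ((L : ℝ) + R - B) :=
    mul_nonneg (by linarith) (by linarith)
  have h_one : 1 - (T₁ + T₂) + T₃ ≤ 0 := by
    have h : 1 - (T₁ + T₂) + T₃ =
        -((D₁ - 1) * ((L : ℝ) + R - B) * (AL + AR) / (R * AL)) := by
      rw [hT₁, hT₂, hT₃]
      field_simp
      ring
    rw [h]
    exact neg_nonpos.2 (by positivity)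
  have hq := sq_sub_mul_add_nonpos_of_le_larger_root h_one hs (hsmax ▸ hsm)
  have hdiff : (((L : ℝ) / (s * B) + (R : ℝ) / B) * (s * AL + AR) - (AL + AR)) * C
      - D₁ * ((((L : ℝ) + (R : ℝ)) / B - 1) * (AL + AR) * C)
      = R * AL * C / (s * B) * (s ^ 2 - (T₁ + T₂) * s + T₃) := by
    rw [hT₁, hT₂, hT₃]
    field_simp
    ring
  have hcoef : 0 ≤ R * AL * C / (s * B) := by positivity
  linarith [mul_nonpos_of_nonneg_of_nonpos hcoef hq]
end
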